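/- A map Φ : H₂(ℂ) → H₂(ℂ) is a J.T.P. homomorphism with Φ(0) = 0, Φ(I) = I, and not vanishing on all rank-one matrices, if and only if there exists a unitary U ∈ M₂(ℂ) such that Φ(A) = U A U* for all A, or Φ(A) = U Aᵀ U* for all A. -/

import Mathlib

open Matrix

namespace JTP

/-- Hermitian matrix with real coordinates. -/
noncomputable def Hm (a d x y : ℝ) : Matrix (Fin 2) (Fin 2) ℂ :=
  !![(a : ℂ), ⟨x, y⟩; ⟨x, -y⟩, (d : ℂ)]

lemma Hm_herm (a d x y : ℝ) : (Hm a d x y).IsHermitian := by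
  ext i j
  fin_cases i <;> fin_cases j <;> simp [Hm, Complex.ext_iff]

lemma exists_Hm {A : Matrix (Fin 2) (Fin 2) ℂ} (h : A.IsHermitian) :
    ∃ a d x y : ℝ, A = Hm a d x y := by
  refine ⟨(A 0 0).re, (A 1 1).re, (A 0 1).re, (A 0 1).im, ?_⟩
  have h00 := h.apply 0 0
  have h11 := h.apply 1 1
  have h01 := h.apply 1 0
  simp only [Complex.ext_iff, Complex.star_def, Complex.conj_re, Complex.conj_im] at h00 h11 h01
  ext i j
  fin_cases i <;> fin_cases j <;> simp [Hm, Complex.ext_iff] <;> (try constructor) <;> linarith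

lemma Hm_inj {a d x y a' d' x' y' : ℝ} :
    Hm a d x y = Hm a' d' x' y' ↔ a = a' ∧ d = d' ∧ x = x' ∧ y = y' := by
  constructor
  · intro h
    have h00 := congrFun (congrFun h 0) 0
    have h01 := congrFun (congrFun h 0) 1
    have h11 := congrFun (congrFun h 1) 1
    simp [Hm, Complex.ext_iff] at h00 h01 h11
    tauto
  · rintro ⟨rfl, rfl, rfl, rfl⟩; rfl

/-- The triple product in coordinates. -/
lemma Hm_triple (a d x y a' d' x' y' : ℝ) :
    Hm a d x y * Hm a' d' x' y' * Hm a d x y =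
      Hm (a^2*a' + 2*a*(x*x'+y*y') + d'*(x^2+y^2))
         (d^2*d' + 2*d*(x*x'+y*y') + a'*(x^2+y^2))
         (a*a'*x + a*d*x' + d*d'*x + (x^2-y^2)*x' + 2*x*y*y')
         (a*a'*y + a*d*y' + d*d'*y + (y^2-x^2)*y' + 2*x*y*x') := by
  ext i j
  fin_cases i <;> fin_cases j <;>
    simp [Hm, Complex.ext_iff, Matrix.mul_apply, Fin.sum_univ_two, pow_two] <;> constructor <;> ring

lemma Hm_one : (1 : Matrix (Fin 2) (Fin 2) ℂ) = Hm 1 1 0 0 := by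
  ext i j
  fin_cases i <;> fin_cases j <;> simp [Hm, Complex.ext_iff]

lemma Hm_zero : (0 : Matrix (Fin 2) (Fin 2) ℂ) = Hm 0 0 0 0 := by
  ext i j
  fin_cases i <;> fin_cases j <;> simp [Hm, Complex.ext_iff]

lemma Hm_transpose (a d x y : ℝ) : (Hm a d x y)ᵀ = Hm a d x (-y) := by
  ext i j
  fin_cases i <;> fin_cases j <;> simp [Hm, Complex.ext_iff]

/-- The functional equation forces the identity on nonnegative reals. -/
lemma fun_eq (c : ℝ → ℝ) (h1 : c 1 = 1) (h0 : c 0 = 0)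
    (hadd : ∀ t, 0 ≤ t → t ≤ 1 → c t + c (1 - t) = 1)
    (hmul : ∀ s t, 0 ≤ t → t ≤ 1 → c (s * t) = c s * c t) :
    ∀ s t, 0 ≤ t → c (s * t) = c s * t := by
  have hmul' : ∀ s t, 0 ≤ t → c (s * t) = c s * c t := by
    intro s t ht
    rcases le_total t 1 with h | h
    · exact hmul s t ht h
    · have htp : 0 < t := by linarith
      have hi : t⁻¹ ≤ 1 := inv_le_one_of_one_le₀ h
      have hi0 : 0 ≤ t⁻¹ := by positivity
      have e1 := hmul (s * t) t⁻¹ hi0 hi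
      have e2 := hmul t t⁻¹ hi0 hi
      rw [mul_inv_cancel₀ htp.ne', h1] at e2
      rw [mul_assoc, mul_inv_cancel₀ htp.ne', mul_one] at e1
      rw [e1, mul_assoc, mul_comm (c t⁻¹), ← e2, mul_one]
  have hpos : ∀ t, 0 ≤ t → 0 ≤ c t := by
    intro t ht
    have := hmul' (√t) (√t) (Real.sqrt_nonneg t)
    rw [Real.mul_self_sqrt ht] at this
    rw [this]; exact mul_self_nonneg _
  have hadd' : ∀ s t, 0 ≤ s → 0 ≤ t → c (s + t) = c s + c t := by
    intro s t hs ht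
    rcases (add_nonneg hs ht).eq_or_lt with h | h
    · have e1 : s = 0 := by linarith
      have e2 : t = 0 := by linarith
      simp [e1, e2, h0]
    · have e := hadd (s / (s + t)) (by positivity) (by rw [div_le_one h]; linarith)
      have e3 : 1 - s / (s + t) = t / (s + t) := by field_simp; ring
      rw [e3] at e
      have e1 := hmul' (s + t) (s / (s + t)) (by positivity)
      have e2 := hmul' (s + t) (t / (s + t)) (by positivity)
      rw [mul_div_cancel₀ _ h.ne'] at e1 e2
      rw [e1, e2, ← mul_add, e, mul_one]
  have hmono : ∀ s t, 0 ≤ s → s ≤ t → c s ≤ c t := by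
    intro s t hs hst
    have := hadd' s (t - s) hs (by linarith)
    have h2 := hpos (t - s) (by linarith)
    rw [add_sub_cancel] at this
    linarith
  have hnat : ∀ n : ℕ, c n = n := by
    intro n
    induction n with
    | zero => simpa using h0
    | succ k ih => push_cast; rw [hadd' _ _ (by positivity) (by norm_num), ih, h1]
  have hid : ∀ t, 0 ≤ t → c t = t := by
    intro t ht
    have key : ∀ n : ℕ, (n : ℝ) * |c t - t| ≤ 1 := by
      intro n
      have hn : (0 : ℝ) ≤ n * t := by positivity
      have l1 := Nat.floor_le hn
      have l2 := (Nat.lt_floor_add_one ((n : ℝ) * t)).le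
      have m1 := hmono _ _ (by positivity) l1
      have m2 := hmono _ _ hn l2
      have e := hmul' n t ht
      rw [hnat] at m1 e
      have e4 := hnat (⌊(n : ℝ) * t⌋₊ + 1)
      push_cast at e4
      rw [e4] at m2
      rw [← abs_of_nonneg (Nat.cast_nonneg (α := ℝ) n), ← abs_mul, abs_le]
      constructor <;> linarith
    by_contra hne
    have hp : 0 < |c t - t| := abs_pos.mpr (sub_ne_zero.mpr hne)
    obtain ⟨n, hn⟩ := exists_nat_gt (1 / |c t - t|)
    rw [div_lt_iff₀ hp] at hn
    linarith [key n]
  intro s t ht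
  rw [hmul' s t ht, hid t ht]

set_option maxHeartbeats 2000000 in
/-- Normalised case. -/
lemma core (Φ : Matrix (Fin 2) (Fin 2) ℂ → Matrix (Fin 2) (Fin 2) ℂ)
    (hH : ∀ A : Matrix (Fin 2) (Fin 2) ℂ, A.IsHermitian → (Φ A).IsHermitian)
    (hJ : ∀ A B : Matrix (Fin 2) (Fin 2) ℂ, A.IsHermitian → B.IsHermitian →
        Φ (A * B * A) = Φ A * Φ B * Φ A)
    (h0 : Φ 0 = 0) (h1 : Φ 1 = 1)
    (hE : Φ (Hm 1 0 0 0) = Hm 1 0 0 0) (hX : Φ (Hm 0 0 1 0) = Hm 0 0 1 0) :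
    (∀ A : Matrix (Fin 2) (Fin 2) ℂ, A.IsHermitian → Φ A = A) ∨
    (∀ A : Matrix (Fin 2) (Fin 2) ℂ, A.IsHermitian → Φ A = Aᵀ) := by
  have hEx : ∀ a d x y, ∃ a' d' x' y', Φ (Hm a d x y) = Hm a' d' x' y' :=
    fun a d x y => exists_Hm (hH _ (Hm_herm a d x y))
  choose fa fd fx fy hf using hEx
  have J : ∀ a d x y a' d' x' y', Φ (Hm a d x y * Hm a' d' x' y' * Hm a d x y) =
      Φ (Hm a d x y) * Φ (Hm a' d' x' y') * Φ (Hm a d x y) :=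
    fun a d x y a' d' x' y' => hJ _ _ (Hm_herm _ _ _ _) (Hm_herm _ _ _ _)
  obtain ⟨c, hc⟩ : ∃ c : ℝ → ℝ, ∀ t, c t = fa t 0 0 0 := ⟨_, fun _ => rfl⟩
  have htE : ∀ t, Φ (Hm t 0 0 0) = Hm (c t) 0 0 0 := by
    intro t
    have := J 1 0 0 0 t 0 0 0
    rw [Hm_triple, hE, hf t, Hm_triple] at this
    rw [hc]
    simpa using this
  have ha : ∀ a d x y, fa a d x y = c a := by
    intro a d x y
    have := J 1 0 0 0 a d x y
    rw [Hm_triple, hE, hf a d, Hm_triple] at this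
    simp [htE, Hm_inj] at this
    exact this.symm
  have hd : ∀ a d x y, fd a d x y = c d := by
    intro a d x y
    have := J 0 0 1 0 a d x y
    rw [Hm_triple, hX, hf a d, Hm_triple] at this
    simp [hf, Hm_inj, ha] at this
    exact this.1.symm
  have c1 : c 1 = 1 := by
    have := htE 1
    rw [hE] at this; simp [Hm_inj] at this; exact this.symm
  have c0 : c 0 = 0 := by
    have := htE 0
    rw [← Hm_zero, h0, Hm_zero] at this; simp [Hm_inj] at this; exact this.symm
  -- symmetries
  have hS : ∀ a x y : ℝ, a^2 + x^2 + y^2 = 1 →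
      c a ^ 2 + fx a (-a) x y ^ 2 + fy a (-a) x y ^ 2 = 1 ∧
      (fx a (-a) x y ^ 2 + fy a (-a) x y ^ 2) + c (-a) ^ 2 = 1 := by
    intro a x y h
    have := J a (-a) x y 1 1 0 0
    rw [Hm_triple, ← Hm_one, h1, Hm_one, hf, hf a, Hm_triple] at this
    have e : Hm (a ^ 2 * 1 + 2 * a * (x * 0 + y * 0) + 1 * (x ^ 2 + y ^ 2))
        ((-a) ^ 2 * 1 + 2 * -a * (x * 0 + y * 0) + 1 * (x ^ 2 + y ^ 2))
        (a * 1 * x + a * -a * 0 + -a * 1 * x + (x ^ 2 - y ^ 2) * 0 + 2 * x * y * 0)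
        (a * 1 * y + a * -a * 0 + -a * 1 * y + (y ^ 2 - x ^ 2) * 0 + 2 * x * y * 0) = 1 := by
      rw [Hm_one, Hm_inj]; refine ⟨?_, ?_, ?_, ?_⟩ <;> linarith
    rw [← hf, e, h1, Hm_one, Hm_inj] at this
    simp only [ha, hd] at this
    obtain ⟨p, q, -, -⟩ := this
    constructor <;> linarith
  have hconj : ∀ a x y a' d' x' y', 
      c (a^2*a' + 2*a*(x*x'+y*y') + d'*(x^2+y^2)) =
      c a ^2 * c a' + 2 * c a *(fx a (-a) x y*fx a' d' x' y'+fy a (-a) x y*fy a' d' x' y')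
        + c d'*(fx a (-a) x y^2+fy a (-a) x y^2) := by
    intro a x y a' d' x' y'
    have := J a (-a) x y a' d' x' y'
    rw [Hm_triple, hf, hf, hf, Hm_triple, Hm_inj] at this
    simp only [ha, hd] at this
    exact this.1
  have hfE : ∀ t, fx t 0 0 0 = 0 ∧ fy t 0 0 0 = 0 := by
    intro t
    have := htE t
    rw [hf, Hm_inj] at this
    exact this.2.2
  have hsq : ∀ s t, 0 ≤ t → t ≤ 1 → c (s * t) = c s * c (√t) ^ 2 := by
    intro s t ht ht1
    have := hconj (√t) (√(1-t)) 0 s 0 0 0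
    simp [hfE, c0, Real.sq_sqrt ht] at this
    rw [mul_comm s, this, mul_comm]
  have hsq1 : ∀ t, 0 ≤ t → t ≤ 1 → c t = c (√t) ^ 2 := by
    intro t ht ht1
    simpa [c1] using hsq 1 t ht ht1
  have hadd : ∀ t, 0 ≤ t → t ≤ 1 → c t + c (1 - t) = 1 := by
    intro t ht ht1
    have hs := hS (√t) (√(1-t)) 0 (by
      rw [Real.sq_sqrt ht, Real.sq_sqrt (by linarith)]; ring)
    have := hconj (√t) (√(1-t)) 0 0 1 0 0
    have := J (√t) (-√t) (√(1-t)) 0 1 0 0 0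
    rw [Hm_triple, hf, hf, hE, Hm_triple, Hm_inj] at this
    simp only [ha, hd] at this
    have t2 := this.2.1
    have e : (-√t) ^ 2 * 0 + 2 * -√t * (√(1 - t) * 0 + 0 * 0) + 1 * (√(1 - t) ^ 2 + 0 ^ 2) = 1 - t := by
      rw [Real.sq_sqrt (by linarith)]; ring
    rw [e] at t2
    rw [t2, hsq1 t ht ht1]
    linarith [hs.1]
  have hlin := fun_eq c c1 c0
    hadd
    (fun s t ht ht1 => by rw [hsq s t ht ht1, ← hsq1 t ht ht1])
  have hidp : ∀ t, 0 ≤ t → c t = t := by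
    intro t ht; simpa [c1] using hlin 1 t ht
  obtain ⟨s, hs0, hs⟩ : ∃ s : ℝ, 0 < s ∧ s ^ 2 = 1 / 2 :=
    ⟨√(1/2), by positivity, Real.sq_sqrt (by norm_num)⟩
  have hcm : c (-1) = -1 := by
    have e := hS s s 0 (by linarith)
    have := J s (-s) s 0 1 (-1) 0 0
    have hm : Hm s (-s) s 0 * Hm 1 (-1) 0 0 * Hm s (-s) s 0 = Hm 0 0 1 0 := by
      rw [Hm_triple, Hm_inj]; refine ⟨?_, ?_, ?_, ?_⟩ <;> nlinarith
    have hneg : c (-s) = c (-1) * s := by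
      have := hlin (-1) s hs0.le
      simpa using this
    rw [hm, hX, hf, hf, Hm_triple, Hm_inj] at this
    simp only [ha, hd, hneg, c1, hidp s hs0.le] at this e
    have hsq := hS 1 0 0 (by norm_num)
    rw [c1] at hsq
    have hz : c (-1) ^ 2 = 1 := by linarith [hsq.1, hsq.2]
    have this' := this
    have : (c (-1) - 1) * (c (-1) + 1) = 0 := by linarith
    rcases mul_eq_zero.mp this with h | h
    · exfalso
      have h' : c (-1) = 1 := by linarith
      rw [h'] at this' e
      have zx : fx 1 (-1) 0 0 = 0 := by
        nlinarith [hsq.1, sq_nonneg (fx 1 (-1) 0 0), sq_nonneg (fy 1 (-1) 0 0)]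
      have zy : fy 1 (-1) 0 0 = 0 := by
        nlinarith [hsq.1, sq_nonneg (fx 1 (-1) 0 0), sq_nonneg (fy 1 (-1) 0 0)]
      rw [zx, zy] at this'
      linarith [this'.1, e.1]
    · linarith
  have hid : ∀ t, c t = t := by
    intro t
    rcases le_total 0 t with h | h
    · exact hidp t h
    · have := hlin (-1) (-t) (by linarith)
      rw [hcm] at this
      simpa using this
  simp only [hid] at hS hconj ha hd
  have hXf : fx 0 0 1 0 = 1 ∧ fy 0 0 1 0 = 0 := by
    rw [hf, Hm_inj] at hX; exact hX.2.2
  have hh : fx s (-s) s 0 = s ∧ fy s (-s) s 0 = 0 := by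
    have e := (hS s s 0 (by linarith)).1
    have := hconj s s 0 0 0 1 0
    rw [hXf.1, hXf.2] at this
    have h2 : fx s (-s) s 0 = s := by
      have : s * (fx s (-s) s 0 - s) = 0 := by linarith
      rcases mul_eq_zero.mp this with h | h <;> linarith
    refine ⟨h2, ?_⟩
    rw [h2] at e
    have : fy s (-s) s 0 ^ 2 = 0 := by linarith
    simpa using this
  have hx : ∀ a d x y, fx a d x y = x := by
    intro a d x y
    have := hconj s s 0 a d x y
    rw [hh.1, hh.2] at this
    have : s * s * (fx a d x y - x) = 0 := by linarith
    have h3 : s * s ≠ 0 := by positivity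
    rcases mul_eq_zero.mp this with h | h
    · exact absurd h h3
    · linarith
  have hk : fy s (-s) 0 s = s ∨ fy s (-s) 0 s = -s := by
    have e := (hS s 0 s (by linarith)).1
    rw [hx] at e
    have : (fy s (-s) 0 s - s) * (fy s (-s) 0 s + s) = 0 := by linarith
    rcases mul_eq_zero.mp this with h | h
    · left; linarith
    · right; linarith
  have hy : ∀ a d x y, s * y = fy s (-s) 0 s * fy a d x y := by
    intro a d x y
    have := hconj s 0 s a d x y
    rw [hx, hx] at this
    have e := (hS s 0 s (by linarith)).1
    rw [hx] at e
    have e2 : fy s (-s) 0 s ^ 2 = s ^ 2 := by linarith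
    rw [e2] at this
    have : s * (s * y - fy s (-s) 0 s * fy a d x y) = 0 := by linarith
    rcases mul_eq_zero.mp this with h | h <;> linarith
  rcases hk with hk | hk
  · left
    intro A hA
    obtain ⟨a, d, x, y, rfl⟩ := exists_Hm hA
    have := hy a d x y
    rw [hk] at this
    have := mul_left_cancel₀ hs0.ne' this
    rw [hf, Hm_inj, ha, hd, hx, ← this]
    simp
  · right
    intro A hA
    obtain ⟨a, d, x, y, rfl⟩ := exists_Hm hA
    have := hy a d x y
    rw [hk] at this
    have : s * y = s * (- fy a d x y) := by linarith
    have := mul_left_cancel₀ hs0.ne' this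
    rw [Hm_transpose, hf, Hm_inj, ha, hd, hx]
    refine ⟨rfl, rfl, rfl, by linarith⟩

/-- Nonvanishing on the first matrix unit. -/
lemma E_ne (Φ : Matrix (Fin 2) (Fin 2) ℂ → Matrix (Fin 2) (Fin 2) ℂ)
    (hJ : ∀ A B : Matrix (Fin 2) (Fin 2) ℂ, A.IsHermitian → B.IsHermitian →
        Φ (A * B * A) = Φ A * Φ B * Φ A)
    (A : Matrix (Fin 2) (Fin 2) ℂ) (hA : A.IsHermitian) (hr : A.rank = 1) (hne : Φ A ≠ 0) :
    Φ (Hm 1 0 0 0) ≠ 0 := by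
  intro hE
  apply hne
  have J : ∀ a d x y a' d' x' y', Φ (Hm a d x y * Hm a' d' x' y' * Hm a d x y) =
      Φ (Hm a d x y) * Φ (Hm a' d' x' y') * Φ (Hm a d x y) :=
    fun a d x y a' d' x' y' => hJ _ _ (Hm_herm _ _ _ _) (Hm_herm _ _ _ _)
  have htE : ∀ t, Φ (Hm t 0 0 0) = 0 := by
    intro t
    have := J 1 0 0 0 t 0 0 0
    rw [Hm_triple, hE] at this
    simpa using this
  have hdet : A.det = 0 := by
    by_contra hd
    have := Matrix.rank_of_isUnit A ((Matrix.isUnit_iff_isUnit_det A).mpr (isUnit_iff_ne_zero.mpr hd))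
    rw [hr] at this
    simp at this
  obtain ⟨a, d, x, y, rfl⟩ := exists_Hm hA
  have hdet' : a * d = x^2 + y^2 := by
    have := congrArg Complex.re hdet
    simp [Hm, Matrix.det_fin_two] at this
    linarith
  by_cases ha : a = 0
  · subst ha
    have hx : x = 0 := by nlinarith
    have hy : y = 0 := by nlinarith
    subst hx hy
    have := J 0 0 1 0 d 0 0 0
    rw [Hm_triple, htE] at this
    simpa using this
  · have := J 1 0 (x/a) (y/a) a 0 0 0
    rw [Hm_triple, htE] at this
    have e : d = a * ((x/a)^2+(y/a)^2) := by
      field_simp; linarith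
    rw [← Matrix.zero_mul (Φ (Hm 1 0 (x / a) (y / a))), ← Matrix.mul_zero (Φ (Hm 1 0 (x / a) (y / a))), ← this]
    congr 1
    rw [Hm_inj]
    refine ⟨by ring, by rw [e]; ring, by field_simp; ring, by field_simp; ring⟩

lemma exists_unit (F : Matrix (Fin 2) (Fin 2) ℂ) (hF : F ≠ 0) (hF2 : F * F = F) :
    ∃ v : Fin 2 → ℂ, F *ᵥ v = v ∧ star v ⬝ᵥ v = 1 := by
  obtain ⟨w, hw⟩ : ∃ w, F *ᵥ w ≠ 0 := by
    by_contra! h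
    apply hF
    ext i j
    have := congrFun (h (Pi.single j 1)) i
    simpa using this
  set u := F *ᵥ w with hu
  have hFu : F *ᵥ u = u := by rw [hu, Matrix.mulVec_mulVec, hF2]
  set n : ℝ := Complex.normSq (u 0) + Complex.normSq (u 1) with hn
  have hnpos : 0 < n := by
    rcases (add_nonneg (Complex.normSq_nonneg (u 0)) (Complex.normSq_nonneg (u 1))).eq_or_lt with h | h
    · exfalso; apply hw
      have z0 : Complex.normSq (u 0) = 0 := by
        linarith [Complex.normSq_nonneg (u 0), Complex.normSq_nonneg (u 1)]
      have z1 : Complex.normSq (u 1) = 0 := by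
        linarith [Complex.normSq_nonneg (u 0), Complex.normSq_nonneg (u 1)]
      ext i
      fin_cases i
      · simpa using z0
      · simpa using z1
    · exact h
  have hdot : star u ⬝ᵥ u = (n : ℂ) := by
    simp [dotProduct, Fin.sum_univ_two, hn, Complex.normSq_eq_conj_mul_self]
  refine ⟨((√n)⁻¹ : ℂ) • u, by rw [Matrix.mulVec_smul, hFu], ?_⟩
  rw [star_smul, smul_dotProduct, dotProduct_smul, hdot]
  have : ((√n : ℝ) : ℂ) * (√n : ℝ) = n := by
    rw [← Complex.ofReal_mul, Real.mul_self_sqrt hnpos.le]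
  have h2 : ((√n : ℝ) : ℂ) ≠ 0 := by
    have := Real.sqrt_pos.mpr hnpos
    exact_mod_cast this.ne'
  simp only [smul_eq_mul, star_inv₀, Complex.star_def, Complex.conj_ofReal]
  rw [← this]
  field_simp

lemma exists_U (F T : Matrix (Fin 2) (Fin 2) ℂ) (hF : F ≠ 0) (hF2 : F * F = F)
    (hFH : F.IsHermitian) (hTH : T.IsHermitian) (hT : T * T = 1) (hFTF : F * T * F = 0) :
    ∃ U ∈ Matrix.unitaryGroup (Fin 2) ℂ, F * U = U * Hm 1 0 0 0 ∧ T * U = U * Hm 0 0 1 0 := by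
  obtain ⟨v, hFv, hv⟩ := exists_unit F hF hF2
  set w := T *ᵥ v with hw
  have hTw : T *ᵥ w = v := by rw [hw, Matrix.mulVec_mulVec, hT, Matrix.one_mulVec]
  have hFw : F *ᵥ w = 0 := by
    rw [hw, ← hFv, Matrix.mulVec_mulVec, Matrix.mulVec_mulVec, hFTF,
      Matrix.zero_mulVec]
  have hsv : star v ᵥ* F = star v := by
    have := congrArg star hFv
    rwa [Matrix.star_mulVec, hFH.eq] at this
  have hsw : star w = star v ᵥ* T := by
    rw [hw, Matrix.star_mulVec, hTH.eq]
  have hvw : star v ⬝ᵥ w = 0 := by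
    rw [← hsv, ← Matrix.dotProduct_mulVec, hFw, dotProduct_zero]
  have hwv : star w ⬝ᵥ v = 0 := by
    rw [hsw, ← Matrix.dotProduct_mulVec, ← hw, hvw]
  have hww : star w ⬝ᵥ w = 1 := by
    rw [hsw, ← Matrix.dotProduct_mulVec, hTw, hv]
  refine ⟨Matrix.of fun i j => ![v, w] j i, ?_, ?_, ?_⟩
  · rw [Matrix.mem_unitaryGroup_iff']
    simp only [dotProduct, Fin.sum_univ_two, Pi.star_apply] at hvw hwv hww hv
    ext i j
    fin_cases i <;> fin_cases j <;>
      simp [Matrix.mul_apply, Fin.sum_univ_two, Matrix.star_apply] <;> assumption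
  · have f0 := congrFun hFv 0
    have f1 := congrFun hFv 1
    have g0 := congrFun hFw 0
    have g1 := congrFun hFw 1
    simp only [Matrix.mulVec, dotProduct, Fin.sum_univ_two, Pi.zero_apply] at f0 f1 g0 g1
    ext i j
    fin_cases i <;> fin_cases j <;>
      simp [Matrix.mul_apply, Fin.sum_univ_two, Hm, f0, f1, g0, g1]
    all_goals exact Or.inr rfl
  · have f0 := congrFun hw.symm 0
    have f1 := congrFun hw.symm 1
    have g0 := congrFun hTw 0
    have g1 := congrFun hTw 1
    simp only [Matrix.mulVec, dotProduct, Fin.sum_univ_two] at f0 f1 g0 g1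
    ext i j
    fin_cases i <;> fin_cases j <;>
      simp [Matrix.mul_apply, Fin.sum_univ_two, Hm,  f0, f1, g0, g1]
    all_goals exact (mul_one _).symm

end JTP

open JTP

theorem jtp_nondegenerate_characterization
    (Φ : Matrix (Fin 2) (Fin 2) ℂ → Matrix (Fin 2) (Fin 2) ℂ) :
    ((∀ A : Matrix (Fin 2) (Fin 2) ℂ, A.IsHermitian → (Φ A).IsHermitian) ∧
     (∀ A B : Matrix (Fin 2) (Fin 2) ℂ, A.IsHermitian → B.IsHermitian →
        Φ (A * B * A) = Φ A * Φ B * Φ A) ∧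
     Φ 0 = 0 ∧ Φ 1 = 1 ∧
     (∃ A : Matrix (Fin 2) (Fin 2) ℂ, A.IsHermitian ∧ A.rank = 1 ∧ Φ A ≠ 0)) ↔
    (∃ U ∈ Matrix.unitaryGroup (Fin 2) ℂ,
      (∀ A : Matrix (Fin 2) (Fin 2) ℂ, A.IsHermitian → Φ A = U * A * star U) ∨
      (∀ A : Matrix (Fin 2) (Fin 2) ℂ, A.IsHermitian → Φ A = U * Aᵀ * star U)) := by
  constructor
  · rintro ⟨hH, hJ, h0, h1, A, hA, hr, hne⟩
    have hEne := E_ne Φ hJ A hA hr hne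
    have hEh := Hm_herm 1 0 0 0
    have hXh := Hm_herm 0 0 1 0
    have hF2 : Φ (Hm 1 0 0 0) * Φ (Hm 1 0 0 0) = Φ (Hm 1 0 0 0) := by
      have := hJ _ 1 hEh isHermitian_one
      rw [h1, Matrix.mul_one (Φ _), Hm_one, Hm_triple] at this
      simpa using this.symm
    have hT2 : Φ (Hm 0 0 1 0) * Φ (Hm 0 0 1 0) = 1 := by
      have := hJ _ 1 hXh isHermitian_one
      rw [h1, Matrix.mul_one (Φ _), Hm_one, Hm_triple] at this
      refine Eq.trans ?_ h1
      rw [Hm_one]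
      simpa using this.symm
    have hFTF : Φ (Hm 1 0 0 0) * Φ (Hm 0 0 1 0) * Φ (Hm 1 0 0 0) = 0 := by
      rw [← hJ _ _ hEh hXh, ← h0, Hm_triple, Hm_zero]
      simp
    obtain ⟨U, hU, hFU, hTU⟩ := exists_U _ _ hEne hF2 (hH _ hEh) (hH _ hXh) hT2 hFTF
    have hU1 : star U * U = 1 := Matrix.mem_unitaryGroup_iff'.mp hU
    have hU2 : U * star U = 1 := Matrix.mem_unitaryGroup_iff.mp hU
    have hback : ∀ M, U * (star U * M * U) * star U = M := by
      intro M
      calc U * (star U * M * U) * star U = (U * star U) * M * (U * star U) := by noncomm_ring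
        _ = M := by rw [hU2]; simp
    refine ⟨U, hU, ?_⟩
    have := core (fun A => star U * Φ A * U) ?_ ?_ ?_ ?_ ?_ ?_
    · rcases this with h | h
      · left; intro A hA; exact (hback (Φ A)).symm.trans (congrArg (fun M => U * M * star U) (h A hA))
      · right; intro A hA; exact (hback (Φ A)).symm.trans (congrArg (fun M => U * M * star U) (h A hA))
    · intro A hA
      exact Matrix.isHermitian_conjTranspose_mul_mul U (hH A hA)
    · intro A B hA hB
      show star U * Φ (A * B * A) * U = (star U * Φ A * U) * (star U * Φ B * U) * (star U * Φ A * U)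
      rw [hJ A B hA hB]
      calc star U * (Φ A * Φ B * Φ A) * U = star U * Φ A * 1 * Φ B * 1 * Φ A * U := by noncomm_ring
        _ = _ := by rw [← hU2]; noncomm_ring
    · simp [h0]
    · simp [h1, hU1]
    · show star U * _ * U = _
      rw [Matrix.mul_assoc, hFU, ← Matrix.mul_assoc, hU1, Matrix.one_mul]
    · show star U * _ * U = _
      rw [Matrix.mul_assoc, hTU, ← Matrix.mul_assoc, hU1, Matrix.one_mul]
  · rintro ⟨U, hU, h⟩
    have hU1 : star U * U = 1 := Matrix.mem_unitaryGroup_iff'.mp hU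
    have hU2 : U * star U = 1 := Matrix.mem_unitaryGroup_iff.mp hU
    have hfront : ∀ M, star U * (U * M * star U) * U = M := by
      intro M
      calc star U * (U * M * star U) * U = (star U * U) * M * (star U * U) := by noncomm_ring
        _ = M := by rw [hU1]; simp
    have hprod : ∀ M N : Matrix (Fin 2) (Fin 2) ℂ, U * (M * N * M) * star U =
        (U * M * star U) * (U * N * star U) * (U * M * star U) := by
      intro M N
      calc U * (M * N * M) * star U = U * M * 1 * N * 1 * M * star U := by noncomm_ring
        _ = _ := by rw [← hU1]; noncomm_ring
    have herm : ∀ A B : Matrix (Fin 2) (Fin 2) ℂ, A.IsHermitian → B.IsHermitian →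
        (A * B * A).IsHermitian := by
      intro A B hA hB
      have := Matrix.isHermitian_conjTranspose_mul_mul A hB
      rwa [hA.eq] at this
    have hrank : (Hm 1 0 0 0).rank = 1 := by
      have : Hm 1 0 0 0 = Matrix.diagonal ![1, 0] := by
        ext i j
        fin_cases i <;> fin_cases j <;> simp [Hm, Complex.ext_iff]
      rw [this, Matrix.rank_diagonal]
      rw [Fintype.card_eq_one_iff]
      refine ⟨⟨0, by simp⟩, ?_⟩
      rintro ⟨i, hi⟩
      fin_cases i
      · rfl
      · simp at hi
    have hne : Hm 1 0 0 0 ≠ 0 := by rw [Hm_zero, Ne, Hm_inj]; simp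
    rcases h with h | h
    · refine ⟨?_, ?_, ?_, ?_, Hm 1 0 0 0, Hm_herm _ _ _ _, hrank, ?_⟩
      · intro A hA; rw [h A hA]; exact Matrix.isHermitian_mul_mul_conjTranspose U hA
      · intro A B hA hB
        rw [h _ (herm A B hA hB), h A hA, h B hB, hprod]
      · rw [h 0 isHermitian_zero]; simp
      · rw [h 1 isHermitian_one]; simp [hU2]
      · intro h'
        rw [h _ (Hm_herm _ _ _ _)] at h'
        apply hne
        rw [← hfront (Hm 1 0 0 0), h']; simp
    · refine ⟨?_, ?_, ?_, ?_, Hm 1 0 0 0, Hm_herm _ _ _ _, hrank, ?_⟩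
      · intro A hA; rw [h A hA]; exact Matrix.isHermitian_mul_mul_conjTranspose U hA.transpose
      · intro A B hA hB
        rw [h _ (herm A B hA hB), h A hA, h B hB, ← hprod]
        simp [Matrix.transpose_mul, Matrix.mul_assoc]
      · rw [h 0 isHermitian_zero]; simp
      · rw [h 1 isHermitian_one]; simp [hU2]
      · intro h'
        rw [h _ (Hm_herm _ _ _ _), Hm_transpose, neg_zero] at h'
        apply hne
        rw [← hfront (Hm 1 0 0 0), h']; simp
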